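/- arXiv:2502.14794 — 2 statements merged into one kernel-verified Lean document; each statement's English description precedes it below -/
import Mathlib

section
/- Let H be a graph with maximum degree at most d, and let 𝒥_{ℓ,x,c} denote the set of subgraphs J ⊆ H with ℓ edges, x non-isolated vertices, and c connected components (excluding isolated vertices). Then |𝒥_{ℓ,x,c}| ≤ C(min{|E(H)|, |V(H)|}, c) · (16d)^ℓ, where C(a,b) denotes the binomial coefficient. -/
open SimpleGraph

/-- The connected components of `J` that contain a non-isolated vertex. -/
def nontrivialComponents {V : Type*} (J : SimpleGraph V) : Set J.ConnectedComponent :=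
  {C | ∃ v ∈ J.support, J.connectedComponentMk v = C}

open Classical in
/-- Weighted disjointness: cylinder families which are pairwise disjoint have total weight at most one. -/
theorem cylinder_weight {α ι : Type*} (E : Finset α) (A : Finset ι) (P Q : ι → Finset α)
    (ℓ m : ℕ) (hP : ∀ i ∈ A, P i ⊆ E) (hQ : ∀ i ∈ A, Q i ⊆ E)
    (hPQ : ∀ i ∈ A, Disjoint (P i) (Q i)) (hPc : ∀ i ∈ A, (P i).card = ℓ)
    (hQc : ∀ i ∈ A, (Q i).card ≤ m)
    (hdis : ∀ i ∈ A, ∀ j ∈ A, ∀ w : Finset α, P i ⊆ w → Disjoint (Q i) w → P j ⊆ w →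
      Disjoint (Q j) w → i = j)
    (p : ℝ) (hp0 : 0 ≤ p) (hp1 : p ≤ 1) :
    (A.card : ℝ) * (p ^ ℓ * (1 - p) ^ m) ≤ 1 := by
  have hq0 : 0 ≤ 1 - p := by linarith
  have hq1 : 1 - p ≤ 1 := by linarith
  let W : Finset α → ℝ := fun w => p ^ w.card * (1 - p) ^ (E.card - w.card)
  let F : ι → Finset (Finset α) := fun i => (E \ (P i ∪ Q i)).powerset.image (fun t => P i ∪ t)
  have hF : ∀ i ∈ A, p ^ ℓ * (1 - p) ^ m ≤ ∑ w ∈ F i, W w := by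
    intro i hi
    have hsub : P i ∪ Q i ⊆ E := Finset.union_subset (hP i hi) (hQ i hi)
    have hdt : ∀ t ∈ (E \ (P i ∪ Q i)).powerset, Disjoint (P i) t := by
      intro t ht
      rw [Finset.mem_powerset] at ht
      rw [Finset.disjoint_left]
      intro a ha hat
      have := ht hat
      simp [ha] at this
    have hinj : Set.InjOn (fun t => P i ∪ t) ((E \ (P i ∪ Q i)).powerset : Set (Finset α)) := by
      intro t ht u hu h
      have h1 := hdt t ht
      have h2 := hdt u hu
      have h' : P i ∪ t = P i ∪ u := h
      rw [← Finset.union_sdiff_cancel_left h1, h', Finset.union_sdiff_cancel_left h2]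
    have hcE : (E \ (P i ∪ Q i)).card + (ℓ + (Q i).card) = E.card := by
      rw [← hPc i hi, ← Finset.card_union_of_disjoint (hPQ i hi)]
      exact Finset.card_sdiff_add_card_eq_card hsub
    have : ∑ w ∈ F i, W w = p ^ ℓ * (1 - p) ^ (Q i).card := by
      rw [Finset.sum_image hinj]
      have h3 := Finset.sum_pow_mul_eq_add_pow p (1 - p) (E \ (P i ∪ Q i))
      rw [add_sub_cancel, one_pow] at h3
      refine Eq.trans ?_ (mul_one (p ^ ℓ * (1 - p) ^ (Q i).card))
      refine Eq.trans ?_ (congrArg (fun z => p ^ ℓ * (1 - p) ^ (Q i).card * z) h3)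
      simp only [Finset.mul_sum]
      apply Finset.sum_congr rfl
      intro t ht
      have hc : (P i ∪ t).card = ℓ + t.card := by
        rw [Finset.card_union_of_disjoint (hdt t ht), hPc i hi]
      have htc : t.card ≤ (E \ (P i ∪ Q i)).card := Finset.card_le_card (Finset.mem_powerset.1 ht)
      have he : E.card - (ℓ + t.card) = (Q i).card + ((E \ (P i ∪ Q i)).card - t.card) := by
        omega
      simp only [W, hc, he, pow_add]
      ring
    rw [this]
    exact mul_le_mul_of_nonneg_left (pow_le_pow_of_le_one hq0 hq1 (hQc i hi)) (by positivity)
  have hmem : ∀ i ∈ A, ∀ w ∈ F i, P i ⊆ w ∧ Disjoint (Q i) w ∧ w ⊆ E := by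
    intro i hi w hw
    simp only [F, Finset.mem_image, Finset.mem_powerset] at hw
    obtain ⟨t, ht, rfl⟩ := hw
    refine ⟨Finset.subset_union_left, ?_, ?_⟩
    · rw [Finset.disjoint_union_right]
      refine ⟨(hPQ i hi).symm, ?_⟩
      rw [Finset.disjoint_left]
      intro a ha hat
      have := ht hat
      simp [ha] at this
    · exact Finset.union_subset (hP i hi) (ht.trans Finset.sdiff_subset)
  calc (A.card : ℝ) * (p ^ ℓ * (1 - p) ^ m) = ∑ i ∈ A, p ^ ℓ * (1 - p) ^ m := by simp
    _ ≤ ∑ i ∈ A, ∑ w ∈ F i, W w := Finset.sum_le_sum hF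
    _ = ∑ w ∈ A.biUnion F, W w := by
        rw [Finset.sum_biUnion]
        intro i hi j hj hij
        rw [Function.onFun, Finset.disjoint_left]
        intro w hw hw'
        obtain ⟨a, b, -⟩ := hmem i hi w hw
        obtain ⟨a', b', -⟩ := hmem j hj w hw'
        exact hij (hdis i hi j hj w a b a' b')
    _ ≤ ∑ w ∈ E.powerset, W w := by
        apply Finset.sum_le_sum_of_subset_of_nonneg
        · intro w hw
          obtain ⟨i, hi, hw⟩ := Finset.mem_biUnion.1 hw
          exact Finset.mem_powerset.2 (hmem i hi w hw).2.2
        · intro w _ _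
          positivity
    _ = 1 := by
        have := Finset.sum_pow_mul_eq_add_pow p (1 - p) E
        rw [add_sub_cancel, one_pow] at this
        exact this

/-- The subgraphs of `H` with `ℓ` edges all of whose nontrivial components meet `S ⊆ supp J`. -/
def rootedFamily {V : Type*} (H : SimpleGraph V) (ℓ : ℕ) (S : Set V) : Set (SimpleGraph V) :=
  {J | J ≤ H ∧ J.edgeSet.ncard = ℓ ∧ S ⊆ J.support ∧ ∀ v ∈ J.support, ∃ s ∈ S, J.Reachable s v}

theorem support_ncard_le {V : Type*} [Fintype V] (J : SimpleGraph V) :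
    J.support.ncard ≤ 2 * J.edgeSet.ncard := by
  classical
  have h : J.support.toFinset ⊆ J.edgeSet.toFinset.biUnion (fun e => e.toFinset) := by
    intro v hv
    rw [Set.mem_toFinset, SimpleGraph.mem_support] at hv
    obtain ⟨w, hw⟩ := hv
    rw [Finset.mem_biUnion]
    exact ⟨s(v, w), by simpa using hw, by simp⟩
  rw [Set.ncard_eq_toFinset_card', Set.ncard_eq_toFinset_card', mul_comm]
  refine (Finset.card_le_card h).trans (Finset.card_biUnion_le_card_mul _ _ _ ?_)
  intro e he
  induction e with
  | _ a b =>
    rw [Sym2.toFinset_mk_eq]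
    exact Finset.card_le_two

/-- Edges of `H` touching a set `W`. -/
theorem touching_card {V : Type*} [Fintype V] (d : ℕ) (H : SimpleGraph V)
    (hdeg : ∀ v, (H.neighborSet v).ncard ≤ d) (W : Set V) :
    {e | e ∈ H.edgeSet ∧ ∃ v ∈ W, v ∈ e}.ncard ≤ W.ncard * d := by
  classical
  have h : {e | e ∈ H.edgeSet ∧ ∃ v ∈ W, v ∈ e}.toFinset ⊆
      W.toFinset.biUnion (fun v => (H.neighborSet v).toFinset.image (fun w => s(v, w))) := by
    intro e he
    rw [Set.mem_toFinset] at he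
    obtain ⟨h1, v, hv, hve⟩ := he
    obtain ⟨w, rfl⟩ := hve
    rw [Finset.mem_biUnion]
    refine ⟨v, by simpa using hv, ?_⟩
    rw [Finset.mem_image]
    exact ⟨w, by simpa using h1, rfl⟩
  rw [Set.ncard_eq_toFinset_card', Set.ncard_eq_toFinset_card']
  refine (Finset.card_le_card h).trans (Finset.card_biUnion_le_card_mul _ _ _ ?_)
  intro v hv
  refine Finset.card_image_le.trans ?_
  rw [← Set.ncard_eq_toFinset_card']
  exact hdeg v

theorem rooted_le {V : Type*} {H : SimpleGraph V} {ℓ : ℕ} {S : Set V} {J K : SimpleGraph V}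
    (hJ : J ∈ rootedFamily H ℓ S) (hK : K ∈ rootedFamily H ℓ S)
    (h : ∀ v w, v ∈ J.support → K.Adj v w → J.Adj v w) : K ≤ J := by
  have key : ∀ s v, K.Walk s v → s ∈ J.support → v ∈ J.support := by
    intro s v p
    induction p with
    | nil => exact id
    | cons hadj p ih =>
      intro hs
      exact ih ((SimpleGraph.mem_support _).2 ⟨_, (h _ _ hs hadj).symm⟩)
  intro v w hvw
  obtain ⟨s, hs, ⟨p⟩⟩ := hK.2.2.2 v ((SimpleGraph.mem_support _).2 ⟨w, hvw⟩)
  exact h v w (key s v p (hJ.2.2.1 hs)) hvw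

theorem rootedFamily_ncard_le {V : Type*} [Fintype V] (d ℓ : ℕ) (H : SimpleGraph V)
    (hdeg : ∀ v, (H.neighborSet v).ncard ≤ d) (S : Set V) :
    (rootedFamily H ℓ S).ncard ≤ (16 * d) ^ ℓ := by
  classical
  rcases Nat.eq_zero_or_pos d with rfl | hd
  · have hbot : ∀ J ≤ H, J = ⊥ := by
      intro J hJ
      rw [eq_bot_iff]
      intro v w hvw
      have h1 := hdeg v
      rw [Nat.le_zero, Set.ncard_eq_zero] at h1
      have h2 : w ∈ H.neighborSet v := hJ hvw
      rw [h1] at h2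
      exact h2.elim
    rcases Nat.eq_zero_or_pos ℓ with rfl | hl
    · simp only [pow_zero]
      rw [← Set.ncard_singleton (⊥ : SimpleGraph V)]
      exact Set.ncard_le_ncard (fun J hJ => hbot J hJ.1)
    · have : rootedFamily H ℓ S = ∅ := by
        rw [Set.eq_empty_iff_forall_notMem]
        intro J hJ
        have h1 := hJ.2.1
        rw [hbot J hJ.1] at h1
        simp at h1
        omega
      simp [this]
  have hdR : (0 : ℝ) < d := by exact_mod_cast hd
  have hd1 : (1 : ℝ) ≤ d := by exact_mod_cast hd
  have hp1 : 1 / (2 * (d : ℝ)) ≤ 1 := by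
    rw [div_le_one (by positivity)]; linarith
  have main := cylinder_weight H.edgeSet.toFinset (rootedFamily H ℓ S).toFinset
    (fun J => J.edgeSet.toFinset)
    (fun J => {e | e ∈ H.edgeSet ∧ ∃ v ∈ J.support, v ∈ e}.toFinset \ J.edgeSet.toFinset)
    ℓ (2 * ℓ * d) ?_ ?_ ?_ ?_ ?_ ?_ (1 / (2 * d)) (by positivity) hp1
  · rw [← Set.ncard_eq_toFinset_card'] at main
    have hb : (1 : ℝ) / 2 ≤ (1 - 1 / (2 * d)) ^ d := by
      have := one_add_mul_le_pow (a := -(1 / (2 * (d : ℝ)))) (by linarith) d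
      have e : (1 : ℝ) + d * -(1 / (2 * (d : ℝ))) = 1 / 2 := by field_simp; norm_num
      rw [e] at this
      simpa [sub_eq_add_neg] using this
    have hb2 : ((1 : ℝ) / 2) ^ (2 * ℓ) ≤ (1 - 1 / (2 * d)) ^ (2 * ℓ * d) := by
      rw [mul_comm _ d, pow_mul _ d]
      exact pow_le_pow_left₀ (by norm_num) hb _
    have h8 : (1 / (8 * (d : ℝ))) ^ ℓ ≤ (1 / (2 * d)) ^ ℓ * (1 - 1 / (2 * d)) ^ (2 * ℓ * d) := by
      refine le_trans (le_of_eq ?_) (mul_le_mul_of_nonneg_left hb2 (by positivity))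
      rw [pow_mul, ← mul_pow]
      congr 1
      field_simp
      norm_num
    have h9 := (mul_le_mul_of_nonneg_left h8 (Nat.cast_nonneg _)).trans main
    rw [div_pow, one_pow, mul_one_div, div_le_one (by positivity)] at h9
    have h10 : (rootedFamily H ℓ S).ncard ≤ (8 * d) ^ ℓ := by exact_mod_cast h9
    exact h10.trans (Nat.pow_le_pow_left (by omega) _)
  · intro J hJ
    rw [Set.mem_toFinset] at hJ
    exact Set.toFinset_subset_toFinset.2 (SimpleGraph.edgeSet_mono hJ.1)
  · intro J hJ e he
    simp only [Finset.mem_sdiff, Set.mem_toFinset] at he ⊢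
    exact he.1.1
  · intro J hJ
    exact Finset.disjoint_sdiff
  · intro J hJ
    rw [Set.mem_toFinset] at hJ
    rw [← Set.ncard_eq_toFinset_card']
    exact hJ.2.1
  · intro J hJ
    rw [Set.mem_toFinset] at hJ
    refine (Finset.card_le_card Finset.sdiff_subset).trans ?_
    rw [← Set.ncard_eq_toFinset_card']
    refine (touching_card d H hdeg J.support).trans ?_
    refine Nat.mul_le_mul_right _ ?_
    rw [← hJ.2.1]
    exact support_ncard_le J
  · have aux : ∀ J ∈ rootedFamily H ℓ S, ∀ K ∈ rootedFamily H ℓ S, ∀ w : Finset (Sym2 V),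
        Disjoint ({e | e ∈ H.edgeSet ∧ ∃ v ∈ J.support, v ∈ e}.toFinset \ J.edgeSet.toFinset) w →
        K.edgeSet.toFinset ⊆ w → K ≤ J := by
      intro J hJ K hK w hd hs
      refine rooted_le hJ hK ?_
      intro a b ha hab
      by_contra hn
      refine (Finset.disjoint_left.1 hd : ∀ ⦃e⦄, _ → e ∉ w) (?_ : s(a, b) ∈ _) (hs (by simpa using hab))
      simp only [Finset.mem_sdiff, Set.mem_toFinset]
      exact ⟨⟨hK.1 hab, a, ha, by simp⟩, hn⟩
    intro J hJ K hK w h1 h2 h3 h4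
    rw [Set.mem_toFinset] at hJ hK
    exact le_antisymm (aux K hK J hJ w h4 h1) (aux J hJ K hK w h2 h3)

theorem count_by_roots {V ι : Type*} [Fintype V] (d ℓ c : ℕ) (H : SimpleGraph V)
    (hdeg : ∀ v, (H.neighborSet v).ncard ≤ d) (T : Finset ι) (f : ι → V)
    (hι : V → Nonempty ι)
    (𝒥 : Set (SimpleGraph V))
    (h𝒥 : ∀ J ∈ 𝒥, J ≤ H ∧ J.edgeSet.ncard = ℓ ∧ (nontrivialComponents J).ncard = c)
    (hT : ∀ J ∈ 𝒥, ∀ C ∈ nontrivialComponents J, ∃ i ∈ T, f i ∈ J.support ∧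
      J.connectedComponentMk (f i) = C) :
    𝒥.ncard ≤ T.card.choose c * (16 * d) ^ ℓ := by
  classical
  have hsub : 𝒥.toFinset ⊆
      (T.powersetCard c).biUnion (fun R => (rootedFamily H ℓ (f '' (R : Set ι))).toFinset) := by
    intro J hJ
    rw [Set.mem_toFinset] at hJ
    obtain ⟨h1, h2, h3⟩ := h𝒥 J hJ
    have hex : ∀ C : J.ConnectedComponent, ∃ i, C ∈ nontrivialComponents J →
        i ∈ T ∧ f i ∈ J.support ∧ J.connectedComponentMk (f i) = C := by
      intro C
      by_cases hC : C ∈ nontrivialComponents J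
      · obtain ⟨i, hi⟩ := hT J hJ C hC
        exact ⟨i, fun _ => hi⟩
      · obtain ⟨v, -⟩ := C.exists_rep
        exact ⟨(hι v).some, fun h => absurd h hC⟩
    choose g hg using hex
    have hg1 := fun C hC => (hg C hC).1
    have hg2 := fun C hC => (hg C hC).2.1
    have hg3 := fun C hC => (hg C hC).2.2
    rw [Finset.mem_biUnion]
    refine ⟨(nontrivialComponents J).toFinset.image g, ?_, ?_⟩
    · rw [Finset.mem_powersetCard]
      constructor
      · intro i hi
        simp only [Finset.mem_image, Set.mem_toFinset] at hi
        obtain ⟨C, hC, rfl⟩ := hi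
        exact hg1 C hC
      · rw [Finset.card_image_of_injOn, ← Set.ncard_eq_toFinset_card', h3]
        intro C hC D hD hCD
        rw [Finset.mem_coe, Set.mem_toFinset] at hC hD
        rw [← hg3 C hC, ← hg3 D hD, hCD]
    · rw [Set.mem_toFinset]
      refine ⟨h1, h2, ?_, ?_⟩
      · rintro _ ⟨i, hi, rfl⟩
        simp only [Finset.coe_image, Set.mem_image, Finset.mem_coe, Set.mem_toFinset] at hi
        obtain ⟨C, hC, rfl⟩ := hi
        exact hg2 C hC
      · intro v hv
        have hC : J.connectedComponentMk v ∈ nontrivialComponents J := ⟨v, hv, rfl⟩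
        refine ⟨f (g (J.connectedComponentMk v)), ⟨_, ?_, rfl⟩, ?_⟩
        · simp only [Finset.coe_image, Set.mem_image, Finset.mem_coe, Set.mem_toFinset]
          exact ⟨_, hC, rfl⟩
        · exact SimpleGraph.ConnectedComponent.exact (hg3 _ hC)
  rw [Set.ncard_eq_toFinset_card', ← Finset.card_powersetCard]
  refine (Finset.card_le_card hsub).trans (Finset.card_biUnion_le_card_mul _ _ _ ?_)
  intro R _
  rw [← Set.ncard_eq_toFinset_card']
  exact rootedFamily_ncard_le d ℓ H hdeg _

/-- For a graph `H` of maximum degree at most `d`, the number of subgraphs `J ⊆ H` with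
`ℓ` edges, `x` non-isolated vertices, and `c` connected components (excluding isolated
vertices) is at most `C(min{|E(H)|, |V(H)|}, c) ⬝ (16d)^ℓ`. -/
theorem count_subgraphs_with_parameters {V : Type*} [Fintype V]
    (d ℓ x c : ℕ) (H : SimpleGraph V)
    (hdeg : ∀ v, (H.neighborSet v).ncard ≤ d) :
    {J : SimpleGraph V | J ≤ H ∧ J.edgeSet.ncard = ℓ ∧ J.support.ncard = x ∧
        (nontrivialComponents J).ncard = c}.ncard
      ≤ (min H.edgeSet.ncard (Fintype.card V)).choose c * (16 * d) ^ ℓ := by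
  classical
  rcases le_total H.edgeSet.ncard (Fintype.card V) with h | h
  · rw [min_eq_left h, Set.ncard_eq_toFinset_card' H.edgeSet]
    refine count_by_roots d ℓ c H hdeg _ (fun e => (Quot.out e).1) (fun v => ⟨s(v, v)⟩) _
      (fun J hJ => ⟨hJ.1, hJ.2.1, hJ.2.2.2⟩) ?_
    rintro J hJ _ ⟨v, hv, rfl⟩
    obtain ⟨w, hw⟩ := (SimpleGraph.mem_support _).1 hv
    refine ⟨s(v, w), by simpa using hJ.1 hw, ?_⟩
    have hm : (Quot.out s(v, w)).1 ∈ s(v, w) := Sym2.out_fst_mem _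
    rcases Sym2.mem_iff.1 hm with h1 | h1
    · simp only [h1]
      exact ⟨hv, trivial⟩
    · simp only [h1]
      exact ⟨(SimpleGraph.mem_support _).2 ⟨v, hw.symm⟩,
        SimpleGraph.ConnectedComponent.sound hw.symm.reachable⟩
  · rw [min_eq_right h, ← Finset.card_univ]
    refine count_by_roots d ℓ c H hdeg _ id (fun v => ⟨v⟩) _
      (fun J hJ => ⟨hJ.1, hJ.2.1, hJ.2.2.2⟩) ?_
    rintro J hJ _ ⟨v, hv, rfl⟩
    exact ⟨v, Finset.mem_univ _, hv, rfl⟩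
end

section
/- Let F be the square of a Hamilton cycle on n vertices. Every subgraph of F that is the square of a path on k ≥ 3 vertices has exactly 2k−3 edges, and every induced connected subgraph of F on k vertices (3 ≤ k ≤ n−3) has edge boundary of size at least 6, with equality if and only if it is the square of a path. -/
open SimpleGraph

/-- The square of the `n`-cycle on `Fin n`: vertices at (cyclic) distance 1 or 2 are
adjacent. -/
def cycleSq (n : ℕ) : SimpleGraph (Fin n) :=
  SimpleGraph.fromRel (fun u v => (u.val + 1) % n = v.val ∨ (u.val + 2) % n = v.val)

/-- The edge boundary of a subgraph `H` of `G`. -/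
def edgeBoundary {V : Type*} (G : SimpleGraph V) (H : G.Subgraph) : Set (Sym2 V) :=
  {e | ∃ u v, e = s(u, v) ∧ G.Adj u v ∧ u ∈ H.verts ∧ v ∉ H.verts}

/-- `H` is the square of a path on `k` vertices: there is an injective enumeration of its
vertices such that two of them are adjacent in `H` iff their indices differ by 1 or 2. -/
def IsPathSquareSub {V : Type*} {G : SimpleGraph V} (H : G.Subgraph) (k : ℕ) : Prop :=
  ∃ f : Fin k → V, Function.Injective f ∧ H.verts = Set.range f ∧
    ∀ u v, H.Adj u v ↔ ∃ i j : Fin k, f i = u ∧ f j = v ∧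
      (i.val + 1 = j.val ∨ j.val + 1 = i.val ∨ i.val + 2 = j.val ∨ j.val + 2 = i.val)

/-- Number of cyclic changes of a Boolean sequence in a window of length `n`. -/
def chg (n : ℕ) (Y : ℕ → Bool) : ℕ := ((Finset.range n).filter (fun i => Y i ≠ Y (i + 1))).card

lemma chg_parity (n : ℕ) (Y : ℕ → Bool) : chg n Y % 2 = if Y 0 ≠ Y n then 1 else 0 := by
  induction n with
  | zero => simp [chg]
  | succ n ih =>
    have h : chg (n + 1) Y = chg n Y + if Y n ≠ Y (n + 1) then 1 else 0 := by
      unfold chg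
      rw [Finset.range_add_one, Finset.filter_insert]
      split_ifs with h
      · rw [Finset.card_insert_of_notMem (by simp)]
      · simp
    rw [h, Nat.add_mod, ih]
    cases Y 0 <;> cases Y n <;> cases Y (n + 1) <;> simp

lemma chg_even (n : ℕ) (Y : ℕ → Bool) (hY : Function.Periodic Y n) : chg n Y % 2 = 0 := by
  rw [chg_parity]
  have := hY 0
  simp at this
  simp [this]

lemma chg_window (n a : ℕ) (Y : ℕ → Bool) (hY : Function.Periodic Y n) :
    ((Finset.Ico a (a + n)).filter (fun i => Y i ≠ Y (i + 1))).card = chg n Y := by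
  have hp : Function.Periodic (fun i => Y i ≠ Y (i + 1)) n := by
    intro i
    have h1 := hY i
    have h2 := hY (i + 1)
    have : i + n + 1 = i + 1 + n := by omega
    simp only [this, h1, h2]
  rw [Nat.filter_Ico_card_eq_of_periodic _ _ _ hp, Nat.count_eq_card_filter_range]
  rfl

lemma cnt_window (n a : ℕ) (Y : ℕ → Bool) (hY : Function.Periodic Y n) :
    ((Finset.Ico a (a + n)).filter (fun i => Y i = true)).card =
      ((Finset.range n).filter (fun i => Y i = true)).card := by
  have hp : Function.Periodic (fun i => Y i = true) n := by
    intro i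
    have h1 := hY i
    simp only [h1]
  rw [Nat.filter_Ico_card_eq_of_periodic _ _ _ hp, Nat.count_eq_card_filter_range]

lemma per_mul {n : ℕ} {Y : ℕ → Bool} (hY : Function.Periodic Y n) (i t : ℕ) :
    Y (i + t * n) = Y i := by
  have := (hY.nat_mul t) i
  simpa using this

lemma arc (n : ℕ) (hn : 0 < n) (Y : ℕ → Bool) (hY : Function.Periodic Y n) (h2 : chg n Y ≤ 2)
    (i0 i1 : ℕ) (h0 : Y i0 = false) (h1 : Y i1 = true) :
    ∃ a m, 1 ≤ m ∧ m < n ∧ ∀ j < n, Y (a + j) = decide (j < m) := by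
  obtain ⟨a, ha, hb⟩ : ∃ a, Y a = true ∧ Y (a + n - 1) = false := by
    by_contra hcon
    push Not at hcon
    have key : ∀ i, Y i = false → Y (i + 1) = false := by
      intro i hi
      by_contra h
      have h' : Y (i + 1) = true := by simpa using h
      have := hcon (i + 1) h'
      have e : i + 1 + n - 1 = i + n := by omega
      rw [e, hY i] at this
      exact this hi
    have key2 : ∀ t, Y (i0 + t) = false := by
      intro t
      induction t with
      | zero => exact h0
      | succ t ih => exact key _ ih
    have h3 := per_mul hY i1 i0
    have h4 : i0 ≤ i0 * n := Nat.le_mul_of_pos_right _ hn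
    have h5 := key2 (i1 + i0 * n - i0)
    have e : i0 + (i1 + i0 * n - i0) = i1 + i0 * n := by omega
    rw [e, h3, h1] at h5
    exact absurd h5 (by simp)
  have hex : ∃ m, Y (a + m) = false := ⟨n - 1, by rw [← hb]; congr 1; omega⟩
  classical
  set m := Nat.find hex with hm
  have hm1 : Y (a + m) = false := Nat.find_spec hex
  have hm2 : ∀ j < m, Y (a + j) = true := by
    intro j hj
    have := Nat.find_min hex hj
    simpa using this
  have hmn : m ≤ n - 1 := Nat.find_min' hex (by rw [← hb]; congr 1; omega)
  have hmpos : 1 ≤ m := by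
    by_contra h
    have : m = 0 := by omega
    rw [this] at hm1
    simp [ha] at hm1
  refine ⟨a, m, hmpos, by omega, ?_⟩
  have key : ∀ j, m ≤ j → j < n → Y (a + j) = false := by
    intro j hj
    induction j, hj using Nat.le_induction with
    | base => intro _; exact hm1
    | succ j hj ih =>
      intro hjn
      have ihj := ih (by omega)
      by_contra hne
      have hs : ({a + m - 1, a + n - 1, a + j} : Finset ℕ) ⊆
          (Finset.Ico a (a + n)).filter (fun i => Y i ≠ Y (i + 1)) := by
        intro z hz
        simp only [Finset.mem_insert, Finset.mem_singleton] at hz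
        rw [Finset.mem_filter, Finset.mem_Ico]
        rcases hz with rfl | rfl | rfl
        · refine ⟨by omega, ?_⟩
          have e1 : a + m - 1 = a + (m - 1) := by omega
          have e2 : a + m - 1 + 1 = a + m := by omega
          rw [e2, hm1, e1, hm2 _ (by omega)]; simp
        · refine ⟨by omega, ?_⟩
          have e2 : a + n - 1 + 1 = a + n := by omega
          rw [e2, hb, hY a, ha]; simp
        · refine ⟨by omega, ?_⟩
          rw [ihj]
          intro h; exact hne h.symm
      have hc := Finset.card_le_card hs
      rw [chg_window n a Y hY] at hc
      rw [Finset.card_insert_of_notMem (by simp; omega),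
        Finset.card_insert_of_notMem (by simp; omega), Finset.card_singleton] at hc
      omega
  intro j hj
  by_cases h : j < m
  · simp [h, hm2 j h]
  · simp [h, key j (by omega) hj]

lemma combo (n k : ℕ) (X : ℕ → Bool) (hX : Function.Periodic X n) (hk : 3 ≤ k) (hkn : k + 3 ≤ n)
    (hc : ((Finset.range n).filter (fun i => X i = true)).card = k)
    (hle : chg n X + chg n (fun i => xor (X i) (X (i + 1))) ≤ 6) :
    6 ≤ chg n X + chg n (fun i => xor (X i) (X (i + 1))) ∧
    ((∃ a, ∀ j < n, X (a + j) = decide (j < k)) ∨ (n = 6 ∧ ∀ j, X (j + 1) = !(X j))) := by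
  set c : ℕ → Bool := fun i => xor (X i) (X (i + 1)) with hcdef
  have hcp : Function.Periodic c n := by
    intro i
    have e : i + n + 1 = i + 1 + n := by omega
    simp only [hcdef, e, hX i, hX (i + 1)]
  have ev1 := chg_even n X hX
  have ev2 := chg_even n c hcp
  -- few exceptions are impossible
  have exc : ∀ a, ∀ v : Bool, ∀ E : Finset ℕ, E.card ≤ 2 →
      (∀ i, a ≤ i → i < a + n → X i ≠ v → i ∈ E) → False := by
    intro a v E hE h
    have hw := cnt_window n a X hX
    rw [hc] at hw
    have htot := Finset.card_filter_add_card_filter_not (s := Finset.Ico a (a + n))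
      (fun i => X i = true)
    rw [hw, Nat.card_Ico] at htot
    cases v with
    | false =>
      have : (Finset.Ico a (a + n)).filter (fun i => X i = true) ⊆ E := by
        intro i hi
        rw [Finset.mem_filter, Finset.mem_Ico] at hi
        exact h i hi.1.1 hi.1.2 (by simp [hi.2])
      have := Finset.card_le_card this
      omega
    | true =>
      have : (Finset.Ico a (a + n)).filter (fun i => ¬ X i = true) ⊆ E := by
        intro i hi
        rw [Finset.mem_filter, Finset.mem_Ico] at hi
        exact h i hi.1.1 hi.1.2 hi.2
      have := Finset.card_le_card this
      omega
  obtain ⟨i1, hi1⟩ : ∃ i, X i = true := by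
    by_contra hcon
    push Not at hcon
    refine exc 0 false ∅ (by simp) ?_
    intro i _ _ h
    exact absurd (by simpa using h) (hcon i)
  obtain ⟨i0, hi0⟩ : ∃ i, X i = false := by
    by_contra hcon
    push Not at hcon
    refine exc 0 true ∅ (by simp) ?_
    intro i _ _ h
    exact absurd (by simpa using h) (hcon i)
  have cstep : ∀ i, X (i + 1) = xor (X i) (c i) := by
    intro i; simp only [hcdef]; cases X i <;> cases X (i + 1) <;> rfl
  have d1card : chg n X = ((Finset.range n).filter (fun i => c i = true)).card := by
    unfold chg; congr 1; ext i; simp only [Finset.mem_filter, hcdef]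
    cases X i <;> cases X (i + 1) <;> simp
  have cstep0 : ∀ i t : ℕ, (∀ s < t, c (i + s) = false) → X (i + t) = X i := by
    intro i t
    induction t with
    | zero => intro _; rfl
    | succ t ih =>
      intro h
      have := cstep (i + t)
      rw [h t (by omega), ih (fun s hs => h s (by omega))] at this
      rw [← add_assoc, this]; simp
  -- there is a change
  obtain ⟨p1, hp1⟩ : ∃ i, c i = true := by
    by_contra hcon
    push Not at hcon
    have h0 : ∀ i, X i = X 0 := by
      intro i
      have := cstep0 0 i (fun s _ => by simpa using hcon (0 + s))
      simpa using this
    rw [h0 i0] at hi0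
    rw [h0 i1, hi0] at hi1
    exact absurd hi1 (by simp)
  by_cases hall : ∀ i, c i = true
  · have : chg n X = n := by
      rw [d1card, Finset.filter_true_of_mem (fun i _ => hall i), Finset.card_range]
    refine ⟨by omega, Or.inr ⟨by omega, ?_⟩⟩
    intro j
    rw [cstep, hall]; simp
  · push Not at hall
    obtain ⟨p0, hp0⟩ := hall
    have hp0 : c p0 = false := by simpa using hp0
    have d2pos : chg n c ≠ 0 := by
      intro hz
      unfold chg at hz
      rw [Finset.card_eq_zero, Finset.filter_eq_empty_iff] at hz
      have hall2 : ∀ i, c i = c (i + 1) := by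
        intro i
        have e := Nat.mod_add_div i n
        have := hz (x := i % n) (by simp; exact Nat.mod_lt _ (by omega))
        have h1 := per_mul hcp (i % n) (i / n)
        have h2 := per_mul hcp (i % n + 1) (i / n)
        rw [mul_comm, e] at h1
        have e2 : i % n + 1 + i / n * n = i + 1 := by rw [mul_comm]; omega
        rw [e2] at h2
        rw [h1, h2]
        simpa using this
      have hc0 : ∀ i, c i = c 0 := by
        intro i
        induction i with
        | zero => rfl
        | succ i ih => rw [← hall2, ih]
      rw [hc0 p0] at hp0
      rw [hc0 p1, hp0] at hp1
      exact absurd hp1 (by simp)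
    have d1pos : chg n X ≠ 0 := by
      intro hz
      rw [d1card, Finset.card_eq_zero, Finset.filter_eq_empty_iff] at hz
      have := hz (x := p1 % n) (by simp; exact Nat.mod_lt _ (by omega))
      have h1 := per_mul hcp (p1 % n) (p1 / n)
      rw [mul_comm, Nat.mod_add_div] at h1
      rw [← h1] at this
      exact this hp1
    have d2ne : chg n c ≠ 2 ∨ 4 < chg n X := by
      by_contra hcon
      push Not at hcon
      obtain ⟨hd2, hd1⟩ := hcon
      obtain ⟨a, m, hm1, hmn, harc⟩ := arc n (by omega) c hcp (by omega) p0 p1 hp0 hp1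
      have hm4 : m ≤ 4 := by
        have hw := cnt_window n a c hcp
        rw [← d1card] at hw
        have hs : Finset.Ico a (a + m) ⊆ (Finset.Ico a (a + n)).filter (fun i => c i = true) := by
          intro i hi
          rw [Finset.mem_Ico] at hi
          rw [Finset.mem_filter, Finset.mem_Ico]
          refine ⟨by omega, ?_⟩
          have := harc (i - a) (by omega)
          have e : a + (i - a) = i := by omega
          rw [e] at this
          rw [this]; simp; omega
        have := Finset.card_le_card hs
        rw [hw, Nat.card_Ico] at this
        omega
      have tail : ∀ j, m ≤ j → j < n → X (a + j) = X a := by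
        intro j hj hjn
        have := cstep0 (a + j) (n - j) (by
          intro s hs
          rw [add_assoc, harc (j + s) (by omega)]
          simp; omega)
        rw [← this]
        have e : a + j + (n - j) = a + n := by omega
        rw [e, hX a]
      have two : X (a + 2) = X a := by
        by_cases h : m ≤ 2
        · exact tail 2 h (by omega)
        · have h0 := harc 0 (by omega)
          have h1 := harc 1 (by omega)
          have s0 := cstep a
          have s1 := cstep (a + 1)
          rw [add_zero] at h0
          rw [h0] at s0
          rw [h1, s0] at s1
          have e : a + 2 = a + 1 + 1 := rfl
          have q0 : 0 < m := by omega
          have q1 : 1 < m := by omega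
          rw [e, s1]; simp [q0, q1]
      refine exc a (X a) {a + 1, a + 3} Finset.card_le_two ?_
      intro i hi hin hne
      simp only [Finset.mem_insert, Finset.mem_singleton]
      by_contra hcon
      have e : a + (i - a) = i := by omega
      rcases Nat.lt_or_ge (i - a) m with h | h
      · have : i = a ∨ i = a + 2 := by omega
        rcases this with rfl | rfl
        · exact hne rfl
        · exact hne two
      · have := tail (i - a) h (by omega)
        rw [e] at this
        exact hne this
    refine ⟨by omega, Or.inl ?_⟩
    obtain ⟨a, m, hm1, hmn, harc⟩ := arc n (by omega) X hX (by omega) i0 i1 hi0 hi1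
    have hmk : m = k := by
      have hw := cnt_window n a X hX
      rw [hc] at hw
      have hs : (Finset.Ico a (a + n)).filter (fun i => X i = true) = Finset.Ico a (a + m) := by
        ext i
        rw [Finset.mem_filter, Finset.mem_Ico, Finset.mem_Ico]
        constructor
        · rintro ⟨⟨h1, h2⟩, h3⟩
          have := harc (i - a) (by omega)
          have e : a + (i - a) = i := by omega
          rw [e, h3] at this
          have := of_decide_eq_true this.symm
          omega
        · rintro ⟨h1, h2⟩
          refine ⟨by omega, ?_⟩
          have := harc (i - a) (by omega)
          have e : a + (i - a) = i := by omega
          rw [e] at this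
          rw [this]; simp; omega
      rw [hs, Nat.card_Ico] at hw
      omega
    subst hmk
    exact ⟨a, harc⟩

lemma pathSq_edges {V : Type*} {G : SimpleGraph V} (H : G.Subgraph) (k : ℕ) (hk : 3 ≤ k)
    (h : IsPathSquareSub H k) : H.edgeSet.ncard = 2 * k - 3 := by
  obtain ⟨t, rfl⟩ : ∃ t, k = t + 3 := ⟨k - 3, by omega⟩
  obtain ⟨f, hf, hv, hadj⟩ := h
  let g : Fin (t + 2) ⊕ Fin (t + 1) → Sym2 V := fun z => match z with
    | Sum.inl i => s(f ⟨i.val, by omega⟩, f ⟨i.val + 1, by omega⟩)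
    | Sum.inr i => s(f ⟨i.val, by omega⟩, f ⟨i.val + 2, by omega⟩)
  have hg : Function.Injective g := by
    rintro (i | i) (j | j) hij <;>
    simp only [g, Sym2.eq_iff, hf.eq_iff, Fin.mk.injEq] at hij
    · congr 1; ext; omega
    · omega
    · omega
    · congr 1; ext; omega
  have hr : H.edgeSet = Set.range g := by
    ext e
    induction e using Sym2.ind with
    | _ u v =>
    rw [SimpleGraph.Subgraph.mem_edgeSet, hadj]
    constructor
    · rintro ⟨i, j, rfl, rfl, h | h | h | h⟩
      · refine ⟨Sum.inl ⟨i, by omega⟩, ?_⟩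
        have e : j = ⟨i.val + 1, by omega⟩ := by ext; simp; omega
        simp only [g, e]
      · refine ⟨Sum.inl ⟨j, by omega⟩, ?_⟩
        have e : i = ⟨j.val + 1, by omega⟩ := by ext; simp; omega
        simp only [g, e]
        exact Sym2.eq_swap
      · refine ⟨Sum.inr ⟨i, by omega⟩, ?_⟩
        have e : j = ⟨i.val + 2, by omega⟩ := by ext; simp; omega
        simp only [g, e]
      · refine ⟨Sum.inr ⟨j, by omega⟩, ?_⟩
        have e : i = ⟨j.val + 2, by omega⟩ := by ext; simp; omega
        simp only [g, e]
        exact Sym2.eq_swap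
    · rintro ⟨i | i, hi⟩ <;> simp only [g, Sym2.eq_iff] at hi <;>
      rcases hi with ⟨h1, h2⟩ | ⟨h1, h2⟩
      · exact ⟨_, _, h1, h2, by simp⟩
      · exact ⟨_, _, h2, h1, by simp⟩
      · exact ⟨_, _, h1, h2, by simp⟩
      · exact ⟨_, _, h2, h1, by simp⟩
  rw [hr, ← Nat.card_coe_set_eq, Nat.card_range_of_injective hg]
  simp
  omega

/-- Cyclic shift on `Fin n`. -/
def nx {n : ℕ} (s : ℕ) (i : Fin n) : Fin n := ⟨(i.val + s) % n, Nat.mod_lt _ i.pos⟩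

lemma nx_val {n : ℕ} (s : ℕ) (hs : s < n) (i : Fin n) :
    ((nx s i).val = i.val + s ∧ i.val + s < n) ∨ ((nx s i).val + n = i.val + s) := by
  have hi := i.isLt
  simp only [nx]
  rcases Nat.lt_or_ge (i.val + s) n with h | h
  · left; exact ⟨Nat.mod_eq_of_lt h, h⟩
  · right
    rw [Nat.mod_eq_sub_mod h, Nat.mod_eq_of_lt (by omega)]; omega

lemma nx_inj {n : ℕ} (s : ℕ) (hs : s < n) : Function.Injective (nx s : Fin n → Fin n) := by
  intro i j h
  have h1 := nx_val s hs i
  have h2 := nx_val s hs j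
  have hi := i.isLt
  have hj := j.isLt
  rw [h] at h1
  ext; omega

lemma adj_iff {n : ℕ} (hn : 6 ≤ n) (u v : Fin n) : (cycleSq n).Adj u v ↔
    v = nx 1 u ∨ v = nx 2 u ∨ u = nx 1 v ∨ u = nx 2 v := by
  have hu := u.isLt
  have hv := v.isLt
  have h1 := nx_val 1 (by omega) u
  have h2 := nx_val 2 (by omega) u
  have h3 := nx_val 1 (by omega) v
  have h4 := nx_val 2 (by omega) v
  have e : ∀ s, ∀ i : Fin n, (i.val + s) % n = (nx s i).val := fun _ _ => rfl
  simp only [cycleSq, SimpleGraph.fromRel_adj, e, Fin.ext_iff, ne_eq]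
  omega

/-- Edges of the cycle square of step 1 with `P1` and of step 2 with `P2`. -/
def edgesOf {n : ℕ} (P1 P2 : Fin n → Prop) : Set (Sym2 (Fin n)) :=
  {e | (∃ i, P1 i ∧ e = s(i, nx 1 i)) ∨ (∃ i, P2 i ∧ e = s(i, nx 2 i))}

lemma edgesOf_ncard {n : ℕ} (hn : 6 ≤ n) (P1 P2 : Fin n → Prop) [DecidablePred P1]
    [DecidablePred P2] : (edgesOf P1 P2).ncard =
      (Finset.univ.filter P1).card + (Finset.univ.filter P2).card := by
  have i1 : Function.Injective (fun i : Fin n => s(i, nx 1 i)) := by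
    intro i j h
    have h1 := nx_val 1 (by omega) i
    have h2 := nx_val 1 (by omega) j
    simp only [Sym2.eq_iff, Fin.ext_iff] at h
    have hi := i.isLt
    have hj := j.isLt
    ext; omega
  have i2 : Function.Injective (fun i : Fin n => s(i, nx 2 i)) := by
    intro i j h
    have h1 := nx_val 2 (by omega) i
    have h2 := nx_val 2 (by omega) j
    simp only [Sym2.eq_iff, Fin.ext_iff] at h
    have hi := i.isLt
    have hj := j.isLt
    ext; omega
  have he : edgesOf P1 P2 = ((Finset.univ.filter P1).image (fun i : Fin n => s(i, nx 1 i)) ∪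
      (Finset.univ.filter P2).image (fun i : Fin n => s(i, nx 2 i)) : Finset (Sym2 (Fin n))) := by
    ext e
    simp [edgesOf, eq_comm]
  rw [he, Set.ncard_coe_finset, Finset.card_union_of_disjoint, Finset.card_image_of_injective _ i1,
    Finset.card_image_of_injective _ i2]
  rw [Finset.disjoint_left]
  intro e h1 h2
  simp only [Finset.mem_image] at h1 h2
  obtain ⟨i, -, rfl⟩ := h1
  obtain ⟨j, -, h⟩ := h2
  have h1 := nx_val 1 (by omega) i
  have h2 := nx_val 2 (by omega) j
  simp only [Sym2.eq_iff, Fin.ext_iff] at h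
  have hi := i.isLt
  have hj := j.isLt
  omega

lemma shake {n : ℕ} (s : ℕ) (hs : s < n) (x : Fin n → Bool) :
    (Finset.univ.filter (fun i => x i ≠ x (nx s i))).card +
      2 * (Finset.univ.filter (fun i => x i = true ∧ x (nx s i) = true)).card =
    2 * (Finset.univ.filter (fun i => x i = true)).card := by
  have hb : Function.Bijective (nx s : Fin n → Fin n) := (nx_inj s hs).bijective_of_finite
  have h := hb.sum_comp (fun i => if x i = true then 1 else 0)
  simp only [Finset.card_filter]
  rw [two_mul (∑ i, if x i = true then 1 else 0)]
  nth_rewrite 2 [← h]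
  rw [Finset.mul_sum, ← Finset.sum_add_distrib, ← Finset.sum_add_distrib]
  refine Finset.sum_congr rfl fun i _ => ?_
  cases x i <;> cases x (nx s i) <;> simp

lemma boundary_eq {n : ℕ} (hn : 6 ≤ n) (H : (cycleSq n).Subgraph) (x : Fin n → Bool)
    (hx : ∀ i, i ∈ H.verts ↔ x i = true) : edgeBoundary (cycleSq n) H =
      edgesOf (fun i => x i ≠ x (nx 1 i)) (fun i => x i ≠ x (nx 2 i)) := by
  have hn1 : ∀ i : Fin n, (cycleSq n).Adj i (nx 1 i) := fun i => (adj_iff hn _ _).2 (by simp)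
  have hn2 : ∀ i : Fin n, (cycleSq n).Adj i (nx 2 i) := fun i => (adj_iff hn _ _).2 (by simp)
  ext e
  simp only [edgeBoundary, edgesOf, Set.mem_ofPred_eq, hx]
  constructor
  · rintro ⟨u, v, rfl, ha, hu, hv⟩
    rcases (adj_iff hn u v).1 ha with rfl | rfl | rfl | rfl
    · exact Or.inl ⟨_, by simp [hu, hv], rfl⟩
    · exact Or.inr ⟨_, by simp [hu, hv], rfl⟩
    · exact Or.inl ⟨v, by simp [hu, hv], Sym2.eq_swap⟩
    · exact Or.inr ⟨v, by simp [hu, hv], Sym2.eq_swap⟩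
  · rintro (⟨i, hi, rfl⟩ | ⟨i, hi, rfl⟩)
    · cases hxi : x i with
      | true => exact ⟨i, _, rfl, hn1 i, hxi, by simpa [hxi] using hi⟩
      | false => exact ⟨_, i, Sym2.eq_swap, (hn1 i).symm, by simpa [hxi] using hi, by simp [hxi]⟩
    · cases hxi : x i with
      | true => exact ⟨i, _, rfl, hn2 i, hxi, by simpa [hxi] using hi⟩
      | false => exact ⟨_, i, Sym2.eq_swap, (hn2 i).symm, by simpa [hxi] using hi, by simp [hxi]⟩

lemma ind_adj {n : ℕ} (H : (cycleSq n).Subgraph) (hi : H.IsInduced) (u v : Fin n) :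
    H.Adj u v ↔ (cycleSq n).Adj u v ∧ u ∈ H.verts ∧ v ∈ H.verts :=
  ⟨fun h => ⟨h.adj_sub, h.fst_mem, h.snd_mem⟩, fun h => hi h.2.1 h.2.2 h.1⟩

lemma edgeSet_eq {n : ℕ} (hn : 6 ≤ n) (H : (cycleSq n).Subgraph) (hi : H.IsInduced)
    (x : Fin n → Bool) (hx : ∀ i, i ∈ H.verts ↔ x i = true) : H.edgeSet =
      edgesOf (fun i => x i = true ∧ x (nx 1 i) = true)
        (fun i => x i = true ∧ x (nx 2 i) = true) := by
  have hn1 : ∀ i : Fin n, (cycleSq n).Adj i (nx 1 i) := fun i => (adj_iff hn _ _).2 (by simp)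
  have hn2 : ∀ i : Fin n, (cycleSq n).Adj i (nx 2 i) := fun i => (adj_iff hn _ _).2 (by simp)
  ext e
  induction e using Sym2.ind with
  | _ u v =>
  rw [SimpleGraph.Subgraph.mem_edgeSet, ind_adj H hi, hx, hx]
  simp only [edgesOf, Set.mem_ofPred_eq]
  constructor
  · rintro ⟨ha, hu, hv⟩
    rcases (adj_iff hn u v).1 ha with rfl | rfl | rfl | rfl
    · exact Or.inl ⟨_, by simp [hu, hv], rfl⟩
    · exact Or.inr ⟨_, by simp [hu, hv], rfl⟩
    · exact Or.inl ⟨v, by simp [hu, hv], Sym2.eq_swap⟩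
    · exact Or.inr ⟨v, by simp [hu, hv], Sym2.eq_swap⟩
  · rintro (⟨i, ⟨h1, h2⟩, he⟩ | ⟨i, ⟨h1, h2⟩, he⟩) <;>
    rcases Sym2.eq_iff.1 he with ⟨rfl, rfl⟩ | ⟨rfl, rfl⟩
    · exact ⟨hn1 _, h1, h2⟩
    · exact ⟨(hn1 _).symm, h2, h1⟩
    · exact ⟨hn2 _, h1, h2⟩
    · exact ⟨(hn2 _).symm, h2, h1⟩

/-- Residue of a natural number. -/
def rs (n : ℕ) (hn : 0 < n) (j : ℕ) : Fin n := ⟨j % n, Nat.mod_lt _ hn⟩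

lemma rs_add (n : ℕ) (hn : 0 < n) (s j : ℕ) : rs n hn (j + s) = nx s (rs n hn j) := by
  ext; simp [rs, nx]

lemma card_range_fin {n : ℕ} (hn : 0 < n) (P : ℕ → Prop) (Q : Fin n → Prop) [DecidablePred P]
    [DecidablePred Q] (h : ∀ i, P i ↔ Q (rs n hn i)) :
    ((Finset.range n).filter P).card = (Finset.univ.filter Q).card := by
  rw [Finset.card_filter, Finset.card_filter, Finset.sum_range]
  refine Finset.sum_congr rfl fun i _ => ?_
  have : rs n hn i.val = i := by ext; simp [rs, Nat.mod_eq_of_lt i.isLt]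
  simp [h, this]

lemma arc_path {n : ℕ} (hn : 6 ≤ n) (H : (cycleSq n).Subgraph) (hi : H.IsInduced)
    (x : Fin n → Bool) (hx : ∀ i, i ∈ H.verts ↔ x i = true) (k : ℕ) (hk : k + 3 ≤ n) (a : ℕ)
    (ha : ∀ j < n, x (rs n (by omega) (a + j)) = decide (j < k)) : IsPathSquareSub H k := by
  have h0 : 0 < n := by omega
  have inj : ∀ i j, i < n → j < n → rs n h0 (a + i) = rs n h0 (a + j) → i = j := by
    intro i j hi hj h
    have h' : (a + i) % n = (a + j) % n := by simpa [rs] using h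
    have h2 : i % n = j % n := Nat.ModEq.add_left_cancel' a h'
    rwa [Nat.mod_eq_of_lt hi, Nat.mod_eq_of_lt hj] at h2
  have hmem : ∀ u, u ∈ H.verts ↔ ∃ i : Fin k, rs n h0 (a + i) = u := by
    intro u
    rw [hx]
    constructor
    · intro hu
      have hul := u.isLt
      -- index of u
      obtain ⟨j, hj, hju⟩ : ∃ j < n, rs n h0 (a + j) = u := by
        refine ⟨(u.val + (n - a % n)) % n, Nat.mod_lt _ h0, ?_⟩
        ext
        simp only [rs]
        have hal := Nat.mod_lt a h0
        rw [Nat.add_mod_mod, Nat.add_mod, ← Nat.mod_add_mod, Nat.mod_mod, Nat.add_mod_mod]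
        have e : a % n + (u.val + (n - a % n)) = u.val + n := by omega
        rw [e, Nat.add_mod_right, Nat.mod_eq_of_lt hul]
      have := ha j hj
      rw [hju, hu] at this
      exact ⟨⟨j, of_decide_eq_true this.symm⟩, hju⟩
    · rintro ⟨i, rfl⟩
      rw [ha i (by omega)]; simp
  refine ⟨fun i => rs n h0 (a + i), ?_, ?_, ?_⟩
  · intro i j h
    ext; exact inj i j (by omega) (by omega) h
  · ext u; rw [hmem]; rfl
  · intro u v
    rw [ind_adj H hi, hmem, hmem]
    constructor
    · rintro ⟨hadj, ⟨i, rfl⟩, ⟨j, rfl⟩⟩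
      refine ⟨i, j, rfl, rfl, ?_⟩
      rw [adj_iff hn] at hadj
      simp only [← rs_add, add_assoc] at hadj
      rcases hadj with h | h | h | h
      · have := inj _ _ (by omega) (by omega) h; omega
      · have := inj _ _ (by omega) (by omega) h; omega
      · have := inj _ _ (by omega) (by omega) h; omega
      · have := inj _ _ (by omega) (by omega) h; omega
    · rintro ⟨i, j, rfl, rfl, h⟩
      refine ⟨?_, ⟨i, rfl⟩, ⟨j, rfl⟩⟩
      rw [adj_iff hn]
      simp only [← rs_add, add_assoc]
      rcases h with h | h | h | h
      · left; rw [h]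
      · right; right; left; rw [h]
      · right; left; rw [h]
      · right; right; right; rw [h]

lemma alt_path (H : (cycleSq 6).Subgraph) (hi : H.IsInduced)
    (x : Fin 6 → Bool) (hx : ∀ i, i ∈ H.verts ↔ x i = true)
    (ha : ∀ j : Fin 6, x (nx 1 j) = !(x j)) : IsPathSquareSub H 3 := by
  have h1 : x 1 = !(x 0) := ha 0
  have h2 : x 2 = !(x 1) := ha 1
  have h3 : x 3 = !(x 2) := ha 2
  have h4 : x 4 = !(x 3) := ha 3
  have h5 : x 5 = !(x 4) := ha 4
  have hadj := adj_iff (le_refl 6)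
  cases h0 : x 0 with
  | true =>
    have hm : ∀ i, i ∈ H.verts ↔ i.val % 2 = 0 := by
      intro i; rw [hx]; fin_cases i <;> simp_all
    refine ⟨![0, 2, 4], by decide, ?_, ?_⟩
    · ext i; rw [hm, Set.mem_range]; revert i; decide
    · intro u v
      rw [ind_adj H hi, hm, hm, hadj]
      revert u v; decide
  | false =>
    have hm : ∀ i, i ∈ H.verts ↔ i.val % 2 = 1 := by
      intro i; rw [hx]; fin_cases i <;> simp_all
    refine ⟨![1, 3, 5], by decide, ?_, ?_⟩
    · ext i; rw [hm, Set.mem_range]; revert i; decide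
    · intro u v
      rw [ind_adj H hi, hm, hm, hadj]
      revert u v; decide

/-- In the square of a Hamilton cycle: every subgraph that is a square of a path on
`k ≥ 3` vertices has exactly `2k - 3` edges, and every connected induced subgraph on `k`
vertices (`3 ≤ k ≤ n - 3`) has edge boundary of size at least 6, with equality iff it is
the square of a path. -/
theorem cycle_square_path_squares (n : ℕ) :
    (∀ (H : (cycleSq n).Subgraph) (k : ℕ), 3 ≤ k → IsPathSquareSub H k →
        H.edgeSet.ncard = 2 * k - 3) ∧
    (∀ (H : (cycleSq n).Subgraph) (k : ℕ), 3 ≤ k → k ≤ n - 3 →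
        H.IsInduced → H.Connected → H.verts.ncard = k →
        6 ≤ (edgeBoundary (cycleSq n) H).ncard ∧
          ((edgeBoundary (cycleSq n) H).ncard = 6 ↔ IsPathSquareSub H k)) := by
  refine ⟨fun H k hk h => pathSq_edges H k hk h, ?_⟩
  intro H k hk hkn hi _ hcard
  have hn : 6 ≤ n := by omega
  have h0 : 0 < n := by omega
  classical
  let x : Fin n → Bool := fun i => decide (i ∈ H.verts)
  have hx : ∀ i, i ∈ H.verts ↔ x i = true := by intro i; simp [x]
  have hxc : (Finset.univ.filter (fun i => x i = true)).card = k := by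
    rw [← hcard, ← Set.ncard_coe_finset]
    congr 1
    ext i; simp [hx]
  have hB := boundary_eq hn H x hx
  have hE := edgeSet_eq hn H hi x hx
  have hBc := congrArg Set.ncard hB
  rw [edgesOf_ncard hn] at hBc
  have hEc := congrArg Set.ncard hE
  rw [edgesOf_ncard hn] at hEc
  have s1 := shake 1 (by omega) x
  have s2 := shake 2 (by omega) x
  rw [hxc] at s1 s2
  let X : ℕ → Bool := fun j => x (rs n h0 j)
  have hX : Function.Periodic X n := by
    intro j
    simp only [X]
    congr 1
    ext; simp [rs]
  have hXc : ((Finset.range n).filter (fun i => X i = true)).card = k := by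
    rw [← hxc]; exact card_range_fin h0 _ _ (fun i => Iff.rfl)
  have c1 : chg n X = (Finset.univ.filter (fun i => x i ≠ x (nx 1 i))).card := by
    refine card_range_fin h0 _ _ (fun i => ?_)
    simp only [X, rs_add]
  have c2 : chg n (fun i => xor (X i) (X (i + 1))) =
      (Finset.univ.filter (fun i => x i ≠ x (nx 2 i))).card := by
    refine card_range_fin h0 _ _ (fun i => ?_)
    rw [← rs_add]
    change xor (X i) (X (i + 1)) ≠ xor (X (i + 1)) (X (i + 2)) ↔ X i ≠ X (i + 2)
    cases X i <;> cases X (i + 1) <;> cases X (i + 2) <;> simp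
  rw [← c1, ← c2] at hBc
  have comb := combo n k X hX hk (by omega) hXc
  have low : 6 ≤ (edgeBoundary (cycleSq n) H).ncard := by
    by_contra hlt
    have := (comb (by omega)).1
    omega
  refine ⟨low, ?_, ?_⟩
  · intro h6
    rcases (comb (by omega)).2 with ⟨a, ha⟩ | ⟨h6n, ha⟩
    · exact arc_path hn H hi x hx k (by omega) a ha
    · subst h6n
      have : k = 3 := by omega
      subst this
      refine alt_path H hi x hx (fun j => ?_)
      have := ha j.val
      simp only [X, rs_add] at this
      have e : rs 6 h0 j.val = j := by ext; simp [rs, Nat.mod_eq_of_lt j.isLt]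
      rwa [e] at this
  · intro hp
    have := pathSq_edges H k hk hp
    omega
end
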